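/- There is a constant C > 0 such that for every n ≥ 2, the number of Keith numbers with exactly n decimal digits is at most C·10^n/√n. -/

import Mathlib

/-- `keithList a m` is the list of the first `m` terms `K^N_1, …, K^N_m` of the Keith
sequence associated with the digit string `a = [a_1, …, a_n]` (most significant first):
`K^N_m = a_m` for `1 ≤ m ≤ n` and `K^N_m = K^N_{m-1} + ⋯ + K^N_{m-n}` for `m > n`. -/
def keithList (a : List ℕ) : ℕ → List ℕ
  | 0 => []
  | m + 1 =>
      let prev := keithList a m
      prev ++ [if m < a.length then a.getD m 0 else (prev.drop (m - a.length)).sum]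

/-- `keithSeq a m = K^N_m` (1-indexed; `keithSeq a 0 = 0` by convention). -/
def keithSeq (a : List ℕ) (m : ℕ) : ℕ := (keithList a m).getD (m - 1) 0

/-- A Keith number: a positive integer with at least 2 decimal digits that occurs in the
Keith sequence generated by its own decimal digits (most significant first). -/
def IsKeith (N : ℕ) : Prop :=
  2 ≤ (Nat.digits 10 N).length ∧
    ∃ m, 1 ≤ m ∧ keithSeq ((Nat.digits 10 N).reverse) m = N

/-- The sum of the decimal digits of a natural number. -/
def digitSum (N : ℕ) : ℕ := (Nat.digits 10 N).sum

theorem digitSum_add_ten_mul {r : ℕ} (hr : r < 10) (q : ℕ) :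
    digitSum (10 * q + r) = digitSum q + r := by
  unfold digitSum
  by_cases h : r ≠ 0 ∨ q ≠ 0
  · rw [add_comm (10 * q), Nat.digits_add 10 (by norm_num) r q hr h, List.sum_cons, add_comm]
  · push Not at h
    simp [h.1, h.2]

theorem digitSum_pow_mul_add (P : ℕ) :
    ∀ k Q : ℕ, Q < 10 ^ k → digitSum (10 ^ k * P + Q) = digitSum P + digitSum Q
  | 0, Q, hQ => by
    obtain rfl : Q = 0 := by simpa using hQ
    simp [digitSum]
  | k + 1, Q, hQ => by
    have hr : Q % 10 < 10 := Nat.mod_lt _ (by norm_num)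
    have hq : Q / 10 < 10 ^ k := by
      rw [Nat.div_lt_iff_lt_mul (by norm_num)]
      rwa [pow_succ] at hQ
    have hsplit : 10 ^ (k + 1) * P + Q = 10 * (10 ^ k * P + Q / 10) + Q % 10 := by
      have := Nat.div_add_mod Q 10
      rw [pow_succ]
      linarith
    have hQsum := digitSum_add_ten_mul hr (Q / 10)
    rw [Nat.div_add_mod] at hQsum
    rw [hsplit, digitSum_add_ten_mul hr, digitSum_pow_mul_add P k _ hq, hQsum, add_assoc]

theorem digitSum_le_nine_mul_length (N : ℕ) : digitSum N ≤ 9 * (Nat.digits 10 N).length := by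
  have := List.sum_le_card_nsmul (Nat.digits 10 N) 9 fun d hd =>
    Nat.le_of_lt_succ (Nat.digits_lt_base (by norm_num) hd)
  simpa [digitSum, mul_comm] using this

theorem sum_range_mul_eq_sum_sum {M : Type*} [AddCommMonoid M] (f : ℕ → M) (a b : ℕ) :
    ∑ i ∈ Finset.range (a * b), f i =
      ∑ i ∈ Finset.range a, ∑ j ∈ Finset.range b, f (b * i + j) := by
  induction a with
  | zero => simp
  | succ a ih => rw [add_one_mul, Finset.sum_range_add, ih, Finset.sum_range_succ, mul_comm a b]

theorem sum_pow_digitSum {R : Type*} [CommSemiring R] (x : R) (k : ℕ) :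
    ∑ Q ∈ Finset.range (10 ^ k), x ^ digitSum Q = (∑ d ∈ Finset.range 10, x ^ d) ^ k := by
  induction k with
  | zero => simp [digitSum]
  | succ k ih =>
    rw [pow_succ 10, sum_range_mul_eq_sum_sum, pow_succ, ← ih, Finset.sum_mul]
    refine Finset.sum_congr rfl fun q _ => ?_
    rw [Finset.mul_sum]
    refine Finset.sum_congr rfl fun r hr => ?_
    rw [digitSum_add_ten_mul (Finset.mem_range.1 hr), pow_add]

theorem card_digitSum_lt_le (n : ℕ) :
    ((Finset.range (10 ^ n)).filter fun N => digitSum N < n).card ≤ 4 ^ n := by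
  have hsum : ∑ Q ∈ Finset.range (10 ^ n), (1 / 2 : ℝ) ^ digitSum Q ≤ 2 ^ n := by
    rw [sum_pow_digitSum]
    gcongr
    norm_num [Finset.sum_range_succ]
  have hcard : (((Finset.range (10 ^ n)).filter fun N => digitSum N < n).card : ℝ) *
      (1 / 2) ^ n ≤ 2 ^ n := by
    rw [← nsmul_eq_mul]
    refine (Finset.card_nsmul_le_sum _ (fun Q => (1 / 2 : ℝ) ^ digitSum Q) _ ?_).trans
      ((Finset.sum_le_sum_of_subset_of_nonneg (Finset.filter_subset _ _) ?_).trans hsum)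
    · intro Q hQ
      exact pow_le_pow_of_le_one (by norm_num) (by norm_num) (Finset.mem_filter.1 hQ).2.le
    · intros; positivity
  rw [one_div, inv_pow, ← div_eq_mul_inv, div_le_iff₀ (by positivity), ← mul_pow] at hcard
  norm_num at hcard
  exact_mod_cast hcard

theorem centralBinom_sq_mul_le (j : ℕ) : j.centralBinom ^ 2 * (2 * j + 1) ≤ 16 ^ j := by
  induction j with
  | zero => simp
  | succ j ih =>
    have h := Nat.succ_mul_centralBinom_succ j
    have hpos : 0 < (j + 1) ^ 2 := by positivity
    refine Nat.le_of_mul_le_mul_left ?_ hpos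
    calc (j + 1) ^ 2 * ((j + 1).centralBinom ^ 2 * (2 * (j + 1) + 1))
        = ((j + 1) * (j + 1).centralBinom) ^ 2 * (2 * (j + 1) + 1) := by ring
      _ = j.centralBinom ^ 2 * (2 * j + 1) * (4 * ((2 * j + 1) * (2 * j + 3))) := by
        rw [h]; ring
      _ ≤ 16 ^ j * (4 * (4 * (j + 1) ^ 2)) := by
        exact Nat.mul_le_mul ih (Nat.mul_le_mul le_rfl (by nlinarith))
      _ = (j + 1) ^ 2 * 16 ^ (j + 1) := by ring

theorem choose_sq_mul_le (k r : ℕ) : k.choose r ^ 2 * k ≤ 4 ^ k := by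
  obtain ⟨j, rfl | rfl⟩ := Nat.even_or_odd' k
  · calc (2 * j).choose r ^ 2 * (2 * j) ≤ j.centralBinom ^ 2 * (2 * j + 1) := by
          gcongr
          · exact Nat.choose_le_centralBinom r j
          · omega
      _ ≤ 16 ^ j := centralBinom_sq_mul_le j
      _ = 4 ^ (2 * j) := by rw [pow_mul]; norm_num
  · have hle : (2 * j + 1).choose r ≤ 2 * j.centralBinom := by
      cases r with
      | zero => have := Nat.centralBinom_pos j; simp; omega
      | succ r =>
        rw [Nat.choose_succ_succ]
        have h₁ := Nat.choose_le_centralBinom r j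
        have h₂ := Nat.choose_le_centralBinom (r + 1) j
        simp only [Nat.succ_eq_add_one]
        omega
    calc (2 * j + 1).choose r ^ 2 * (2 * j + 1)
        ≤ (2 * j.centralBinom) ^ 2 * (2 * j + 1) := by gcongr
      _ = 4 * (j.centralBinom ^ 2 * (2 * j + 1)) := by ring
      _ ≤ 4 * 16 ^ j := by gcongr; exact centralBinom_sq_mul_le j
      _ = 4 ^ (2 * j + 1) := by rw [pow_succ, pow_mul]; norm_num [mul_comm]

open Polynomial in
theorem sum_coeff_le_eval_one (p : ℕ[X]) (s : Finset ℕ) : ∑ i ∈ s, p.coeff i ≤ p.eval 1 := by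
  rw [Polynomial.eval_eq_sum, Polynomial.sum]
  simp only [one_pow, mul_one]
  exact Finset.sum_le_sum_of_ne_zero fun i _ hi => Polynomial.mem_support_iff.2 hi

open Polynomial in
theorem card_digitSum_eq_le (k t : ℕ) :
    ((Finset.range (10 ^ k)).filter fun Q => digitSum Q = t).card ≤
      5 ^ k * k.choose (k / 2) := by
  have hcoeff : ((Finset.range (10 ^ k)).filter fun Q => digitSum Q = t).card =
      ((∑ d ∈ Finset.range 10, (X : ℕ[X]) ^ d) ^ k).coeff t := by
    rw [← sum_pow_digitSum, Polynomial.finsetSum_coeff, Finset.card_filter]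
    exact Finset.sum_congr rfl fun Q _ => by simp [Polynomial.coeff_X_pow, eq_comm]
  have hfactor : (∑ d ∈ Finset.range 10, (X : ℕ[X]) ^ d) =
      (1 + X ^ 2 + X ^ 4 + X ^ 6 + X ^ 8) * (1 + X) := by
    simp only [Finset.sum_range_succ, Finset.sum_range_zero]
    ring
  rw [hcoeff, hfactor, mul_pow, Polynomial.coeff_mul,
    Finset.Nat.sum_antidiagonal_eq_sum_range_succ_mk]
  calc _ ≤ ∑ i ∈ Finset.range (t + 1),
        ((1 + X ^ 2 + X ^ 4 + X ^ 6 + X ^ 8 : ℕ[X]) ^ k).coeff i * k.choose (k / 2) := by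
        gcongr with i _
        rw [Polynomial.coeff_one_add_X_pow]
        exact Nat.choose_le_middle _ _
    _ ≤ 5 ^ k * k.choose (k / 2) := by
        rw [← Finset.sum_mul]
        gcongr
        refine (sum_coeff_le_eval_one _ _).trans_eq ?_
        simp

theorem card_digitSum_eq_sq_mul_le (k t : ℕ) :
    ((Finset.range (10 ^ k)).filter fun Q => digitSum Q = t).card ^ 2 * k ≤ 100 ^ k :=
  calc _ ≤ (5 ^ k * k.choose (k / 2)) ^ 2 * k := by
        gcongr
        exact card_digitSum_eq_le k t
    _ = 25 ^ k * (k.choose (k / 2) ^ 2 * k) := by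
        rw [mul_pow, ← pow_mul, mul_comm k 2, pow_mul]; norm_num [mul_assoc]
    _ ≤ 25 ^ k * 4 ^ k := by gcongr; exact choose_sq_mul_le k _
    _ = 100 ^ k := by rw [← mul_pow]; norm_num

theorem length_keithList (a : List ℕ) (m : ℕ) : (keithList a m).length = m := by
  induction m with
  | zero => rfl
  | succ m ih => simp [keithList, ih]

theorem keithList_succ (a : List ℕ) (m : ℕ) :
    keithList a (m + 1) = keithList a m ++ [keithSeq a (m + 1)] := by
  simp [keithSeq, keithList, length_keithList]

theorem keithSeq_succ_of_lt {a : List ℕ} {m : ℕ} (h : m < a.length) :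
    keithSeq a (m + 1) = a.getD m 0 := by
  simp [keithSeq, keithList, length_keithList, h]

theorem keithSeq_succ_of_le {a : List ℕ} {m : ℕ} (h : a.length ≤ m) :
    keithSeq a (m + 1) = ((keithList a m).drop (m - a.length)).sum := by
  simp [keithSeq, keithList, length_keithList, h.not_gt]

theorem keithList_eq_take {a : List ℕ} : ∀ {m : ℕ}, m ≤ a.length → keithList a m = a.take m
  | 0, _ => by simp [keithList]
  | m + 1, h => by
    rw [keithList_succ, keithList_eq_take (Nat.le_of_succ_le h), keithSeq_succ_of_lt h,
      List.take_add_one]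
    simp [List.getElem?_eq_getElem h]

theorem keithSeq_length_add_one (a : List ℕ) : keithSeq a (a.length + 1) = a.sum := by
  rw [keithSeq_succ_of_le le_rfl, keithList_eq_take le_rfl]
  simp

theorem getElem_keithList (a : List ℕ) {i m : ℕ} (h : i < (keithList a m).length) :
    (keithList a m)[i] = keithSeq a (i + 1) := by
  induction m with
  | zero => simp [length_keithList] at h
  | succ m ih =>
    simp only [keithList_succ]
    rw [length_keithList] at h
    rcases Nat.lt_succ_iff_lt_or_eq.1 h with h | rfl
    · rw [List.getElem_append_left (by rwa [length_keithList]), ih]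
    · rw [List.getElem_append_right (by rw [length_keithList])]
      simp

theorem keithSeq_length_add_succ {a : List ℕ} (ha : a ≠ []) (m : ℕ) :
    keithSeq a (a.length + m + 2) =
      ((keithList a (a.length + m)).drop (m + 1)).sum + keithSeq a (a.length + m + 1) := by
  have hlen := List.length_pos_iff.2 ha
  rw [keithSeq_succ_of_le (by omega), keithList_succ,
    List.drop_append_of_le_length (by rw [length_keithList]; omega)]
  rw [show a.length + m + 1 - a.length = m + 1 by omega]
  simp

theorem keithSeq_le_succ {a : List ℕ} (ha : a ≠ []) (m : ℕ) :
    keithSeq a (a.length + m + 1) ≤ keithSeq a (a.length + m + 2) := by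
  rw [keithSeq_length_add_succ ha]
  exact Nat.le_add_left _ _

theorem keithSeq_add_eq_two_mul {a : List ℕ} (ha : a ≠ []) (m : ℕ) :
    keithSeq a (a.length + m + 2) + keithSeq a (m + 1) =
      2 * keithSeq a (a.length + m + 1) := by
  have hlen := List.length_pos_iff.2 ha
  have hm : m < (keithList a (a.length + m)).length := by rw [length_keithList]; omega
  have h : keithSeq a (a.length + m + 1) =
      keithSeq a (m + 1) + ((keithList a (a.length + m)).drop (m + 1)).sum := by
    rw [keithSeq_succ_of_le (by omega), show a.length + m - a.length = m by omega,
      List.drop_eq_getElem_cons hm, List.sum_cons, getElem_keithList]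
  rw [keithSeq_length_add_succ ha]
  omega

theorem keithSeq_le_two_pow_mul {a : List ℕ} (ha : a ≠ []) (m : ℕ) :
    keithSeq a (a.length + m + 1) ≤ 2 ^ m * a.sum := by
  induction m with
  | zero => simp [keithSeq_length_add_one]
  | succ m ih =>
    have := keithSeq_add_eq_two_mul ha m
    rw [pow_succ, ← add_assoc]
    linarith

theorem two_pow_length_mul_keithSeq_le {a : List ℕ} (ha : a ≠ []) (h9 : ∀ d ∈ a, d ≤ 9) (m : ℕ) :
    2 ^ a.length * keithSeq a (m + 1) ≤ 9 * 2 ^ a.length + 2 ^ m * a.sum := by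
  rcases lt_or_ge m a.length with h | h
  · have : keithSeq a (m + 1) ≤ 9 := by
      rw [keithSeq_succ_of_lt h, List.getD_eq_getElem _ _ h]
      exact h9 _ (List.getElem_mem h)
    calc _ ≤ 2 ^ a.length * 9 := by gcongr
      _ = 9 * 2 ^ a.length := mul_comm _ _
      _ ≤ _ := Nat.le_add_right _ _
  · obtain ⟨j, rfl⟩ := Nat.exists_eq_add_of_le h
    calc _ ≤ 2 ^ a.length * (2 ^ j * a.sum) := by gcongr; exact keithSeq_le_two_pow_mul ha j
      _ = 2 ^ (a.length + j) * a.sum := by ring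
      _ ≤ _ := Nat.le_add_left _ _

theorem two_pow_mul_sum_le_keithSeq_add {a : List ℕ} (ha : a ≠ []) (h9 : ∀ d ∈ a, d ≤ 9)
    (m : ℕ) :
    2 ^ a.length * (2 ^ m * a.sum + 9) ≤
      2 ^ a.length * keithSeq a (a.length + m + 1) +
        2 ^ m * (9 * 2 ^ a.length + m * a.sum) := by
  induction m with
  | zero => simp [keithSeq_length_add_one]; linarith
  | succ m ih =>
    have hrec := congrArg (2 ^ a.length * ·) (keithSeq_add_eq_two_mul ha m)
    have hle := two_pow_length_mul_keithSeq_le ha h9 m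
    have hnonneg := Nat.zero_le (2 ^ m * a.sum)
    rw [pow_succ 2 m, show a.length + (m + 1) + 1 = a.length + m + 2 by omega]
    linarith

theorem thirty_six_mul_sq_le_two_pow {n : ℕ} (hn : 32 ≤ n) : 36 * n ^ 2 ≤ 2 ^ n := by
  induction n, hn using Nat.le_induction with
  | base => norm_num
  | succ n hn ih => rw [pow_succ 2]; nlinarith

theorem two_pow_mul_sum_le {a : List ℕ} (h9 : ∀ d ∈ a, d ≤ 9) (hlen : 32 ≤ a.length) {m : ℕ}
    (hm : m ≤ 4 * a.length) :
    2 ^ m * a.sum ≤ keithSeq a (a.length + m + 1) + 10 * 2 ^ m := by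
  have ha : a ≠ [] := by rintro rfl; simp at hlen
  have hsum : a.sum ≤ a.length * 9 := by simpa using List.sum_le_card_nsmul a 9 h9
  have hms : m * a.sum ≤ 2 ^ a.length :=
    calc m * a.sum ≤ 4 * a.length * (a.length * 9) := by gcongr
      _ = 36 * a.length ^ 2 := by ring
      _ ≤ _ := thirty_six_mul_sq_le_two_pow hlen
  have h := two_pow_mul_sum_le_keithSeq_add ha h9 m
  have hpos : 0 < 2 ^ a.length := by positivity
  refine Nat.le_of_mul_le_mul_left ?_ hpos
  have := Nat.mul_le_mul_left (2 ^ m) hms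
  linarith

theorem le_keithSeq_of_four_mul_le {a : List ℕ} (h9 : ∀ d ∈ a, d ≤ 9) (hlen : 32 ≤ a.length)
    (hsum : 11 ≤ a.sum) {m : ℕ} (hm : 4 * a.length ≤ m) :
    16 ^ a.length ≤ keithSeq a (a.length + m + 1) := by
  have ha : a ≠ [] := by rintro rfl; simp at hlen
  have hmono : Monotone fun i => keithSeq a (a.length + i + 1) :=
    monotone_nat_of_le_succ fun i => keithSeq_le_succ ha i
  refine le_trans ?_ (hmono hm)
  have h := two_pow_mul_sum_le h9 hlen (le_refl (4 * a.length))
  have h' := Nat.mul_le_mul_left (2 ^ (4 * a.length)) hsum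
  have h16 : 2 ^ (4 * a.length) = 16 ^ a.length := by rw [pow_mul]; norm_num
  rw [h16] at h h'
  simp only
  linarith

/-- A Keith number with many digits and a large digit sum `s` lies within `10 * 2 ^ m` below
`2 ^ m * s` for some `m`. -/
theorem IsKeith.exists_two_pow_mul_digitSum {N : ℕ} (hN : IsKeith N)
    (hlen : 32 ≤ (Nat.digits 10 N).length) (hsum : 11 ≤ digitSum N) :
    ∃ m, N ≤ 2 ^ m * digitSum N ∧ 2 ^ m * digitSum N ≤ N + 10 * 2 ^ m := by
  obtain ⟨-, i, hi, hK⟩ := hN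
  set a := (Nat.digits 10 N).reverse with ha_def
  have hsum_eq : a.sum = digitSum N := by simp [ha_def, digitSum]
  have hlen_eq : a.length = (Nat.digits 10 N).length := by simp [ha_def]
  have h9 : ∀ d ∈ a, d ≤ 9 := fun d hd =>
    Nat.le_of_lt_succ (Nat.digits_lt_base (by norm_num) (List.mem_reverse.1 hd))
  have hlt : N < 10 ^ a.length := by
    rw [hlen_eq]; exact Nat.lt_base_pow_length_digits (by norm_num)
  have hge : 10 ≤ N := by
    have : 10 ^ 1 ≤ N := (Nat.lt_digits_length_iff (by norm_num) N).1 (by omega)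
    simpa using this
  rw [← hlen_eq] at hlen
  rw [← hsum_eq] at hsum ⊢
  have ha : a ≠ [] := by rintro h; simp [h] at hlen
  obtain ⟨i, rfl⟩ := Nat.exists_eq_add_of_le' hi
  rcases lt_or_ge i a.length with h | h
  · rw [keithSeq_succ_of_lt h, List.getD_eq_getElem _ _ h] at hK
    have := h9 _ (List.getElem_mem h)
    omega
  · obtain ⟨m, rfl⟩ := Nat.exists_eq_add_of_le h
    refine ⟨m, ?_, ?_⟩
    · have := keithSeq_le_two_pow_mul ha m
      rwa [hK] at this
    · have hm : m ≤ 4 * a.length := by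
        by_contra! hm
        have h₁ := le_keithSeq_of_four_mul_le h9 hlen hsum hm.le
        have h₂ : 10 ^ a.length ≤ 16 ^ a.length := Nat.pow_le_pow_left (by norm_num) _
        omega
      have := two_pow_mul_sum_le h9 hlen hm
      rwa [hK] at this

theorem card_image_filter_digitSum_sq_mul_le (k P t : ℕ) :
    (((Finset.range (10 ^ k)).filter fun Q => digitSum Q = t).image
      fun Q => 10 ^ k * P + Q).card ^ 2 * k ≤ 100 ^ k :=
  (Nat.mul_le_mul_right k (Nat.pow_le_pow_left Finset.card_image_le 2)).trans
    (card_digitSum_eq_sq_mul_le k t)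

/-- The leading digits `P` of a number `N ∈ [B * P, B * P + B)` with `2 ^ m * s` close to `N`
determine `m` and `s` up to boundedly many choices. -/
theorem exponent_and_sum_mem_window {n B P N s m : ℕ} (hn : 32 ≤ n) (hP : n ≤ 10 * P)
    (hBP : B * P ≤ N) (hN : N < B * P + B) (hs : n ≤ s) (hs' : s ≤ 9 * n)
    (h₁ : N ≤ 2 ^ m * s) (h₂ : 2 ^ m * s ≤ N + 10 * 2 ^ m) :
    (Nat.clog 2 (B * P / (9 * n)) ≤ m ∧ m < Nat.clog 2 (B * P / (9 * n)) + 7) ∧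
      B * P / 2 ^ m ≤ s ∧ s ≤ B * P / 2 ^ m + 100 := by
  have hpos : 0 < 2 ^ m := by positivity
  have hBP_le : B * P ≤ 2 ^ m * (9 * n) := hBP.trans (h₁.trans (Nat.mul_le_mul_left _ hs'))
  have hB : B ≤ 90 * 2 ^ m := by
    refine Nat.le_of_mul_le_mul_right (c := n) ?_ (by omega)
    have := Nat.mul_le_mul_left B hP
    linarith
  have hlow : 2 ^ m * n ≤ 4 * (B * P) := by
    have h₃ : 2 ^ m * n ≤ 2 ^ m * s := Nat.mul_le_mul_left _ hs
    have h₄ : 2 ^ m * 32 ≤ 2 ^ m * n := Nat.mul_le_mul_left _ hn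
    have h₅ : B * 1 ≤ B * P := Nat.mul_le_mul_left _ (by omega)
    linarith
  refine ⟨⟨?_, ?_⟩, ?_, ?_⟩
  · refine Nat.clog_le_of_le_pow ?_
    exact Nat.div_le_of_le_mul (by linarith)
  · set c := Nat.clog 2 (B * P / (9 * n))
    have hc : B * P / (9 * n) ≤ 2 ^ c := Nat.le_pow_clog (by norm_num) _
    have hlt : B * P < 9 * n * (2 ^ c + 1) := by
      rw [mul_comm (9 * n)]
      exact (Nat.div_lt_iff_lt_mul (by omega)).1 (Nat.lt_succ_of_le hc)
    have hone : 9 * n * 1 ≤ 9 * n * 2 ^ c := Nat.mul_le_mul_left _ Nat.one_le_two_pow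
    have : 2 ^ m * n < 2 ^ (c + 7) * n := by
      rw [pow_add]
      have := Nat.zero_le (2 ^ c * n)
      linarith
    exact (Nat.pow_lt_pow_iff_right (by norm_num)).1 (Nat.lt_of_mul_lt_mul_right this)
  · exact Nat.div_le_of_le_mul (hBP.trans h₁)
  · rw [← Nat.sub_le_iff_le_add, Nat.le_div_iff_mul_le hpos, Nat.sub_mul]
    have : s * 2 ^ m ≤ B * P + 100 * 2 ^ m := by linarith
    omega

theorem card_isKeith_le {k L : ℕ} (hn : 32 ≤ k + L) (hL : k + L ≤ 10 ^ L) {A : ℕ}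
    (hA : ∀ P t : ℕ, (((Finset.range (10 ^ k)).filter fun Q => digitSum Q = t).image
      fun Q => 10 ^ k * P + Q).card ≤ A) :
    {N : ℕ | (Nat.digits 10 N).length = k + L ∧ IsKeith N}.ncard ≤
      4 ^ (k + L) + 10 ^ L * 707 * A := by
  set n := k + L
  let c : ℕ → ℕ := fun P => Nat.clog 2 (10 ^ k * P / (9 * n))
  let I := Finset.range (10 ^ L) ×ˢ (Finset.range 7 ×ˢ Finset.range 101)
  let F : ℕ × ℕ × ℕ → Finset ℕ := fun x =>
    ((Finset.range (10 ^ k)).filter fun Q =>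
      digitSum Q = 10 ^ k * x.1 / 2 ^ (c x.1 + x.2.1) + x.2.2 - digitSum x.1).image
        fun Q => 10 ^ k * x.1 + Q
  let T := ((Finset.range (10 ^ n)).filter fun N => digitSum N < n) ∪ I.biUnion F
  have hsub : {N : ℕ | (Nat.digits 10 N).length = n ∧ IsKeith N} ⊆ T := by
    rintro N ⟨hlen, hK⟩
    have hlt : N < 10 ^ n := hlen ▸ Nat.lt_base_pow_length_digits (by norm_num)
    simp only [T, Finset.coe_union, Set.mem_union, Finset.mem_coe]
    rcases lt_or_ge (digitSum N) n with hs | hs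
    · exact Or.inl (Finset.mem_filter.2 ⟨Finset.mem_range.2 hlt, hs⟩)
    right
    obtain ⟨m, h₁, h₂⟩ := hK.exists_two_pow_mul_digitSum (hn.trans_eq hlen.symm) (by omega)
    have hQ : N % 10 ^ k < 10 ^ k := Nat.mod_lt _ (by positivity)
    have hdecomp := Nat.div_add_mod N (10 ^ k)
    have hL0 : L ≠ 0 := by rintro rfl; simp at hL; omega
    have hP : n ≤ 10 * (N / 10 ^ k) := by
      obtain ⟨l, rfl⟩ := Nat.exists_eq_succ_of_ne_zero hL0
      refine hL.trans ?_
      rw [Nat.succ_eq_add_one, pow_succ, mul_comm]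
      gcongr
      rw [Nat.le_div_iff_mul_le (by positivity), ← pow_add]
      exact (Nat.lt_digits_length_iff (by norm_num) N).1 (by omega)
    have hP' : N / 10 ^ k < 10 ^ L := by
      rwa [Nat.div_lt_iff_lt_mul (by positivity), ← pow_add, add_comm]
    have hsum := digitSum_pow_mul_add (N / 10 ^ k) k _ hQ
    rw [hdecomp] at hsum
    obtain ⟨⟨hm, hm'⟩, hs₁, hs₂⟩ := exponent_and_sum_mem_window (B := 10 ^ k) hn hP (by omega)
      (by omega) hs (hlen ▸ digitSum_le_nine_mul_length N) h₁ h₂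
    refine Finset.mem_biUnion.2 ⟨(N / 10 ^ k, m - c (N / 10 ^ k),
      digitSum N - 10 ^ k * (N / 10 ^ k) / 2 ^ m), ?_, ?_⟩
    · simp only [I, Finset.mem_product, Finset.mem_range]
      refine ⟨hP', ?_, by omega⟩
      simp only [c]
      omega
    · refine Finset.mem_image.2 ⟨N % 10 ^ k, Finset.mem_filter.2 ⟨Finset.mem_range.2 hQ, ?_⟩,
        hdecomp⟩
      simp only
      rw [show c (N / 10 ^ k) + (m - c (N / 10 ^ k)) = m from Nat.add_sub_of_le hm]
      omega
  calc _ ≤ T.card := by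
        rw [← Set.ncard_coe_finset]
        exact Set.ncard_le_ncard hsub T.finite_toSet
    _ ≤ _ := (Finset.card_union_le _ _).trans (Nat.add_le_add (card_digitSum_lt_le n) ?_)
  refine (Finset.card_biUnion_le_card_mul I F A fun x _ => hA _ _).trans_eq ?_
  simp [I]

theorem ncard_isKeith_le_ten_pow (n : ℕ) :
    {N : ℕ | (Nat.digits 10 N).length = n ∧ IsKeith N}.ncard ≤ 10 ^ n := by
  calc _ ≤ (Finset.range (10 ^ n) : Set ℕ).ncard := by
        refine Set.ncard_le_ncard ?_ (Finset.finite_toSet _)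
        rintro N ⟨hlen, -⟩
        simpa [hlen] using Nat.lt_base_pow_length_digits (b := 10) (m := N) (by norm_num)
    _ = 10 ^ n := by rw [Set.ncard_coe_finset, Finset.card_range]

/-- The number of Keith numbers with exactly n decimal digits is O(10^n/√n). -/
theorem keith_count_n_digits :
    ∃ C : ℝ, 0 < C ∧ ∀ n : ℕ, 2 ≤ n →
      ({N : ℕ | (Nat.digits 10 N).length = n ∧ IsKeith N}.ncard : ℝ)
        ≤ C * 10 ^ n / Real.sqrt n := by
  refine ⟨2000, by norm_num, fun n hn2 => ?_⟩
  have hsqrt : 0 < Real.sqrt n := Real.sqrt_pos.2 (by positivity)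
  rw [le_div_iff₀ hsqrt]
  rcases lt_or_ge n 32 with hn | hn
  · have hle : Real.sqrt n ≤ 32 := by
      rw [Real.sqrt_le_left (by norm_num)]
      have : (n : ℝ) < 32 := by exact_mod_cast hn
      linarith
    calc _ ≤ (10 : ℝ) ^ n * 32 := by
          gcongr
          exact_mod_cast ncard_isKeith_le_ten_pow n
      _ ≤ 2000 * 10 ^ n := by linarith [pow_pos (by norm_num : (0 : ℝ) < 10) n]
  · have hpow : n ≤ 10 ^ Nat.clog 10 n := Nat.le_pow_clog (by norm_num) n
    have hclog : Nat.clog 10 n ≤ n / 2 := by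
      refine Nat.clog_le_of_le_pow ?_
      have h₁ : n / 2 + 1 ≤ 2 ^ (n / 2) := Nat.lt_two_pow_self
      calc n ≤ 2 ^ (n / 2) * 2 ^ (n / 2) := by nlinarith [Nat.div_add_mod n 2, Nat.mod_lt n two_pos]
        _ = 4 ^ (n / 2) := by rw [← mul_pow]; norm_num
        _ ≤ 10 ^ (n / 2) := Nat.pow_le_pow_left (by norm_num) _
    obtain ⟨k, hk⟩ := Nat.exists_eq_add_of_le' (hclog.trans (Nat.div_le_self n 2))
    set L := Nat.clog 10 n
    have hk2 : n ≤ 2 * k := by omega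
    set A := Nat.sqrt (100 ^ k / k) with hA_def
    have hk0 : 0 < k := by omega
    have hcard := card_isKeith_le (k := k) (L := L) (A := A) (by omega) (by omega) fun P t => by
      rw [hA_def, Nat.le_sqrt', Nat.le_div_iff_mul_le hk0]
      exact card_image_filter_digitSum_sq_mul_le k P t
    rw [← hk] at hcard
    have hA : (A : ℝ) * Real.sqrt n ≤ 2 * 10 ^ k := by
      have hA' : A ^ 2 * k ≤ 100 ^ k :=
        (Nat.le_div_iff_mul_le hk0).1 (Nat.sqrt_le' (100 ^ k / k))
      have hsq : A ^ 2 * n ≤ 2 ^ 2 * 100 ^ k := by nlinarith [Nat.mul_le_mul_left (A ^ 2) hk2]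
      refine le_of_sq_le_sq ?_ (by positivity)
      rw [mul_pow, mul_pow, Real.sq_sqrt (by positivity), ← pow_mul, mul_comm k 2, pow_mul]
      norm_num at hsq ⊢
      exact_mod_cast hsq
    have h4 : (4 : ℝ) ^ n * Real.sqrt n ≤ 10 ^ n := by
      have : Real.sqrt n ≤ 2 ^ n := by
        refine (Real.sqrt_le_left (by positivity)).2 ?_
        have h₁ : (n : ℝ) ≤ 2 ^ n := by exact_mod_cast Nat.lt_two_pow_self.le
        have h₂ : (1 : ℝ) ≤ 2 ^ n := one_le_pow₀ (by norm_num)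
        nlinarith
      calc (4 : ℝ) ^ n * Real.sqrt n ≤ 4 ^ n * 2 ^ n := by gcongr
        _ = 8 ^ n := by rw [← mul_pow]; norm_num
        _ ≤ 10 ^ n := by gcongr; norm_num
    calc _ ≤ ((4 : ℝ) ^ n + 10 ^ L * 707 * A) * Real.sqrt n := by
          gcongr
          exact_mod_cast hcard
      _ = 4 ^ n * Real.sqrt n + 10 ^ L * 707 * (A * Real.sqrt n) := by ring
      _ ≤ 10 ^ n + 10 ^ L * 707 * (2 * 10 ^ k) := by gcongr
      _ = 1415 * 10 ^ n := by rw [hk, pow_add]; ring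
      _ ≤ 2000 * 10 ^ n := by gcongr; norm_num
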